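/- Let ℓ ≥ 2 with 2ℓ < n - 3. If a q-ary NMDS linear code C = [n, n-2ℓ-1, 2ℓ+1] has an ℓ-error-correcting pair (A, B) over F_{q^m} with A = [n, ℓ+2, n-ℓ-2] a full-support code, then B^⊥ = [n, n-ℓ, ℓ+1], and either A*B = C^⊥ or A*B = [n, 2ℓ+1, n-2ℓ-1]. -/

import Mathlib

open Finset

/-- Hamming weight of a vector. -/
noncomputable def wt {F : Type*} [Zero F] {ι : Type*} (c : ι → F) : ℕ :=
  Nat.card {i : ι // c i ≠ 0}

/-- `C` has minimum Hamming distance `d`. -/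
def hasMinDist {F : Type*} [Field F] {ι : Type*} (C : Submodule F (ι → F)) (d : ℕ) : Prop :=
  (∃ c ∈ C, c ≠ 0 ∧ wt c = d) ∧ ∀ c ∈ C, c ≠ 0 → d ≤ wt c

/-- The dual code with respect to the standard inner product. -/
def dualCode {F : Type*} [Field F] {ι : Type*} [Fintype ι] (C : Submodule F (ι → F)) :
    Submodule F (ι → F) where
  carrier := {x | ∀ c ∈ C, ∑ i, x i * c i = 0}
  add_mem' := by
    intro a b ha hb c hc
    simp only [Pi.add_apply, add_mul, Finset.sum_add_distrib, ha c hc, hb c hc, add_zero]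
  zero_mem' := by intro c hc; simp
  smul_mem' := by
    intro r a ha c hc
    simp only [Pi.smul_apply, smul_eq_mul, mul_assoc, ← Finset.mul_sum, ha c hc, mul_zero]

/-- The Schur (coordinatewise) product code: the span of all coordinatewise products. -/
def schurProd {F : Type*} [Field F] {ι : Type*} (A B : Submodule F (ι → F)) :
    Submodule F (ι → F) :=
  Submodule.span F {x | ∃ a ∈ A, ∃ b ∈ B, x = a * b}

/-- A code is full-support if every coordinate carries a nonzero entry of some codeword. -/
def fullSupport {F : Type*} [Field F] {ι : Type*} (A : Submodule F (ι → F)) : Prop :=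
  ∀ i : ι, ∃ a ∈ A, a i ≠ 0

/-- Extension of scalars of a code from `Fq` to an extension field `K`, componentwise. -/
def extendCode (Fq K : Type*) [Field Fq] [Field K] [Algebra Fq K] {ι : Type*}
    (C : Submodule Fq (ι → Fq)) : Submodule K (ι → K) :=
  Submodule.span K ((fun c (i : ι) => algebraMap Fq K (c i)) '' (C : Set (ι → Fq)))

/-- `V` restricts onto all of `F ^ I`: it has a codeword interpolating each unit vector on `I`. -/
def Interpolates {F : Type*} [Field F] {ι : Type*} (V : Submodule F (ι → F)) (I : Finset ι) :
    Prop :=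
  ∀ i ∈ I, ∃ v ∈ V, v i = 1 ∧ ∀ j ∈ I, j ≠ i → v j = 0

section Codes

variable {F : Type*} [Field F] {ι : Type*}

lemma wt_eq_card_filter [Fintype ι] [DecidableEq F] (c : ι → F) :
    wt c = (univ.filter fun i => c i ≠ 0).card := by
  rw [wt, Nat.card_eq_fintype_card, Fintype.card_subtype]

lemma wt_le_card [Fintype ι] (c : ι → F) (S : Finset ι) (h : ∀ i, c i ≠ 0 → i ∈ S) :
    wt c ≤ S.card := by
  classical
  rw [wt_eq_card_filter]
  exact Finset.card_le_card fun i hi => h i (by simpa using hi)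

lemma Interpolates.of_ne_zero {V : Submodule F (ι → F)} {I : Finset ι}
    (h : ∀ i ∈ I, ∃ v ∈ V, v i ≠ 0 ∧ ∀ j ∈ I, j ≠ i → v j = 0) : Interpolates V I := by
  intro i hi
  obtain ⟨v, hv, hvi, hvj⟩ := h i hi
  exact ⟨(v i)⁻¹ • v, V.smul_mem _ hv, by simp [hvi], fun j hj hji => by simp [hvj j hj hji]⟩

lemma Interpolates.card_le_finrank [Fintype ι] {V : Submodule F (ι → F)} {I : Finset ι}
    (h : Interpolates V I) : I.card ≤ Module.finrank F V := by
  classical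
  choose! v hv h1 h0 using h
  have hli : LinearIndependent F (fun i : I => (⟨v i, hv i i.2⟩ : V)) := by
    rw [Fintype.linearIndependent_iff]
    intro g hg j
    have := congrFun (congrArg Subtype.val hg) (j : ι)
    simp only [AddSubmonoidClass.coe_finsetSum, Submodule.coe_smul, Finset.sum_apply,
      Pi.smul_apply, smul_eq_mul, ZeroMemClass.coe_zero, Pi.zero_apply] at this
    rw [Finset.sum_eq_single j] at this
    · simpa [h1 j j.2] using this
    · intro i _ hij
      rw [h0 i i.2 j j.2 (fun e => hij (Subtype.ext e.symm)), mul_zero]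
    · simp
  simpa using hli.fintype_card_le_finrank

/-- A code of dimension exceeding `T.card` has a nonzero codeword vanishing on `T`. -/
lemma exists_ne_zero_forall_eq_zero [Fintype ι] (V : Submodule F (ι → F)) (T : Finset ι)
    (h : T.card < Module.finrank F V) : ∃ v ∈ V, v ≠ 0 ∧ ∀ i ∈ T, v i = 0 := by
  let f : V →ₗ[F] (T → F) := (LinearMap.funLeft F F (Subtype.val : T → ι)).comp V.subtype
  have hf : LinearMap.ker f ≠ ⊥ := by
    apply LinearMap.ker_ne_bot_of_finrank_lt
    simpa using h
  obtain ⟨v, hv, hv0⟩ := Submodule.exists_mem_ne_zero_of_ne_bot hf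
  exact ⟨v, v.2, by simpa using hv0, fun i hi => congrFun (LinearMap.mem_ker.mp hv) ⟨i, hi⟩⟩

/-- Every coordinate set `S` contains an information set for the restriction of `V` to `S`. -/
lemma exists_interpolates_subset (V : Submodule F (ι → F)) (S : Finset ι) :
    ∃ I ⊆ S, Interpolates V I ∧ ∀ v ∈ V, (∀ i ∈ I, v i = 0) → ∀ i ∈ S, v i = 0 := by
  classical
  obtain ⟨I, hI, hmax⟩ := Finset.exists_max_image (S.powerset.filter (Interpolates V)) Finset.card
    ⟨∅, by simp [Interpolates]⟩
  simp only [Finset.mem_filter, Finset.mem_powerset] at hI hmax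
  refine ⟨I, hI.1, hI.2, fun v hv hv0 s hs => ?_⟩
  by_contra hvs
  have hsI : s ∉ I := fun h => hvs (hv0 s h)
  have hins : Interpolates V (insert s I) := by
    apply Interpolates.of_ne_zero
    intro i hi
    rcases Finset.mem_insert.mp hi with rfl | hi
    · refine ⟨v, hv, hvs, fun j hj hji => hv0 j ?_⟩
      exact (Finset.mem_insert.mp hj).resolve_left hji
    · obtain ⟨u, hu, hu1, hu0⟩ := hI.2 i hi
      refine ⟨u - (u s / v s) • v, V.sub_mem hu (V.smul_mem _ hv), by simp [hu1, hv0 i hi], ?_⟩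
      intro j hj hji
      rcases Finset.mem_insert.mp hj with rfl | hj
      · simp [hvs]
      · simp [hu0 j hj hji, hv0 j hj]
  have := hmax (insert s I) ⟨Finset.insert_subset hs hI.1, hins⟩
  rw [Finset.card_insert_of_notMem hsI] at this
  omega

lemma exists_interpolates_card_eq_finrank [Fintype ι] (V : Submodule F (ι → F)) :
    ∃ I, Interpolates V I ∧ I.card = Module.finrank F V := by
  obtain ⟨I, -, hI, hz⟩ := exists_interpolates_subset V Finset.univ
  refine ⟨I, hI, le_antisymm hI.card_le_finrank ?_⟩
  by_contra! hlt
  obtain ⟨v, hv, hv0, hvI⟩ := exists_ne_zero_forall_eq_zero V I hlt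
  exact hv0 (funext fun i => hz v hv hvI i (Finset.mem_univ i))

lemma finrank_dualCode [Fintype ι] (V : Submodule F (ι → F)) :
    Module.finrank F (dualCode V) + Module.finrank F V = Fintype.card ι := by
  classical
  have h : dualCode V = V.dualAnnihilator.comap (dotProductEquiv F ι).toLinearMap := by
    ext x
    simp [dualCode, Submodule.mem_dualAnnihilator, dotProduct]
  have h2 : Module.finrank F (dualCode V) = Module.finrank F V.dualAnnihilator := by
    rw [h]
    exact ((dotProductEquiv F ι).ofSubmodule' V.dualAnnihilator).finrank_eq
  have := Subspace.finrank_add_finrank_dualAnnihilator_eq V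
  rw [Module.finrank_fintype_fun_eq_card] at this
  omega

/-- A code interpolates on every coordinate set smaller than its dual distance. -/
lemma interpolates_of_lt_dual_wt [Fintype ι] (V : Submodule F (ι → F)) (T : Finset ι)
    (h : ∀ c ∈ dualCode V, c ≠ 0 → T.card < wt c) : Interpolates V T := by
  classical
  let f : (ι → F) →ₗ[F] (T → F) := LinearMap.funLeft F F (Subtype.val : T → ι)
  have htop : V.map f = ⊤ := by
    by_contra hne
    obtain ⟨g, hg0, hg⟩ := Submodule.exists_le_ker_of_lt_top _ (lt_top_iff_ne_top.mpr hne)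
    obtain ⟨y, rfl⟩ := (dotProductEquiv F T).surjective g
    let x : ι → F := fun i => if hi : i ∈ T then y ⟨i, hi⟩ else 0
    have hxT : ∀ i, x i ≠ 0 → i ∈ T := fun i hi => by
      by_contra hiT
      exact hi (dif_neg hiT)
    have hx : x ∈ dualCode V := by
      intro c hc
      have hz := hg (Submodule.mem_map_of_mem hc)
      rw [LinearMap.mem_ker, dotProductEquiv_apply_apply, dotProduct] at hz
      rw [← hz, ← Finset.sum_subset (Finset.subset_univ T), ← Finset.sum_coe_sort]
      · refine Finset.sum_congr rfl fun i _ => ?_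
        simp [x, f, LinearMap.funLeft_apply]
      · intro i _ hi
        simp [x, hi]
    have hx0 : x ≠ 0 := by
      rintro h0
      apply hg0
      have : y = 0 := by
        ext i
        have := congrFun h0 (i : ι)
        simpa [x] using this
      rw [this, map_zero]
    exact absurd (h x hx hx0) (not_lt.mpr (wt_le_card x T hxT))
  intro i hi
  have hmem : (Pi.single ⟨i, hi⟩ 1 : T → F) ∈ V.map f := htop ▸ Submodule.mem_top
  obtain ⟨v, hv, hve⟩ := hmem
  refine ⟨v, hv, ?_, fun j hj hji => ?_⟩
  · simpa [f, LinearMap.funLeft_apply] using congrFun hve ⟨i, hi⟩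
  · simpa [f, LinearMap.funLeft_apply, hji] using congrFun hve ⟨j, hj⟩

/-- If `V` interpolates on every `k`-set, then its dual distance exceeds `k`. -/
lemma lt_wt_of_interpolates [Fintype ι] (V : Submodule F (ι → F)) (k : ℕ)
    (h : ∀ T : Finset ι, T.card ≤ k → Interpolates V T) (x : ι → F) (hx : x ∈ dualCode V)
    (hx0 : x ≠ 0) : k < wt x := by
  classical
  by_contra! hk
  rw [wt_eq_card_filter] at hk
  obtain ⟨i, hi⟩ := Function.ne_iff.mp hx0
  obtain ⟨v, hv, hv1, hv0⟩ := h _ hk i (by simpa using hi)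
  have := hx v hv
  rw [Finset.sum_eq_single i] at this
  · exact hi (by simpa [hv1] using this)
  · intro j _ hji
    by_cases hj : x j = 0
    · simp [hj]
    · simp [hv0 j (by simpa using hj) hji]
  · simp

lemma Interpolates.extendCode {K : Type*} [Field K] [Algebra F K] {V : Submodule F (ι → F)}
    {I : Finset ι} (h : Interpolates V I) : Interpolates (extendCode F K V) I := by
  intro i hi
  obtain ⟨v, hv, hv1, hv0⟩ := h i hi
  exact ⟨fun j => algebraMap F K (v j), Submodule.subset_span ⟨v, hv, rfl⟩, by simp [hv1],
    fun j hj hji => by simp [hv0 j hj hji]⟩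

lemma mul_mem_schurProd {A B : Submodule F (ι → F)} {a b : ι → F} (ha : a ∈ A) (hb : b ∈ B) :
    a * b ∈ schurProd A B :=
  Submodule.subset_span ⟨a, ha, b, hb, rfl⟩

/-- The product of a full-support code interpolating on `I` and a code interpolating on every set
`insert i J` interpolates on `I ∪ J`. -/
lemma Interpolates.schurProd_union [DecidableEq ι] {A B : Submodule F (ι → F)} {I J : Finset ι}
    (hA : Interpolates A I) (hAfull : fullSupport A) (hIJ : Disjoint I J)
    (hB : ∀ i ∈ I ∪ J, Interpolates B (insert i J)) : Interpolates (schurProd A B) (I ∪ J) := by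
  have hI : ∀ i ∈ I, ∃ y ∈ schurProd A B, y i = 1 ∧ ∀ j ∈ I ∪ J, j ≠ i → y j = 0 := by
    intro i hi
    obtain ⟨a, ha, ha1, ha0⟩ := hA i hi
    obtain ⟨b, hb, hb1, hb0⟩ := hB i (Finset.mem_union_left _ hi) i (Finset.mem_insert_self _ _)
    refine ⟨a * b, mul_mem_schurProd ha hb, by simp [ha1, hb1], fun j hj hji => ?_⟩
    rcases Finset.mem_union.mp hj with hj | hj
    · simp [ha0 j hj hji]
    · simp [hb0 j (Finset.mem_insert_of_mem hj) hji]
  apply Interpolates.of_ne_zero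
  intro i hi
  by_cases hiI : i ∈ I
  · obtain ⟨y, hy, hy1, hy0⟩ := hI i hiI
    exact ⟨y, hy, by simp [hy1], hy0⟩
  · have hiJ : i ∈ J := (Finset.mem_union.mp hi).resolve_left hiI
    choose! y hy hy1 hy0 using hI
    obtain ⟨a, ha, hai⟩ := hAfull i
    obtain ⟨b, hb, hb1, hb0⟩ := hB i hi i (Finset.mem_insert_self _ _)
    have hval : ∀ j ∈ J, (a * b - ∑ t ∈ I, (a * b) t • y t) j = a j * b j := by
      intro j hj
      simp only [Pi.sub_apply, Finset.sum_apply, Pi.smul_apply, smul_eq_mul]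
      rw [Finset.sum_eq_zero]
      · simp
      · intro t ht
        have hne : j ≠ t := fun e => Finset.disjoint_left.mp hIJ ht (e ▸ hj)
        rw [hy0 t ht j (Finset.mem_union_right _ hj) hne, mul_zero]
    refine ⟨a * b - ∑ t ∈ I, (a * b) t • y t, ?_, ?_, ?_⟩
    · exact Submodule.sub_mem _ (mul_mem_schurProd ha hb)
        (Submodule.sum_mem _ fun t ht => Submodule.smul_mem _ _ (hy t ht))
    · rw [hval i hiJ, hb1, mul_one]
      exact hai
    · intro j hj hji
      rcases Finset.mem_union.mp hj with hjI | hjJ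
      · simp only [Pi.sub_apply, Finset.sum_apply, Pi.smul_apply, smul_eq_mul]
        rw [Finset.sum_eq_single j]
        · simp [hy1 j hjI]
        · intro t ht htj
          rw [hy0 t ht j hj htj.symm, mul_zero]
        · exact fun h => absurd hjI h
      · rw [hval j hjJ, hb0 j (Finset.mem_insert_of_mem hjJ) hji, mul_zero]

/-- A Cauchy–Davenport type bound for the product of a full-support code `A` and a code `B`
interpolating on every set of at most `k + 1` coordinates. -/
lemma finrank_add_le_finrank_schurProd [Fintype ι] (A B : Submodule F (ι → F)) (k : ℕ)
    (hAfull : fullSupport A) (hB : ∀ T : Finset ι, T.card ≤ k + 1 → Interpolates B T)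
    (hk : Module.finrank F A + k ≤ Fintype.card ι) :
    Module.finrank F A + k ≤ Module.finrank F (schurProd A B) := by
  classical
  obtain ⟨I, hI, hIc⟩ := exists_interpolates_card_eq_finrank A
  obtain ⟨J, hJ, hJc⟩ := Finset.exists_subset_card_eq (s := Iᶜ) (n := k)
    (by rw [Finset.card_compl]; omega)
  have hIJ : Disjoint I J := Finset.disjoint_left.mpr fun i hi hiJ =>
    Finset.mem_compl.mp (hJ hiJ) hi
  have := (hI.schurProd_union hAfull hIJ fun i _ =>
    hB (insert i J) (hJc ▸ Finset.card_insert_le i J)).card_le_finrank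
  rwa [Finset.card_union_of_disjoint hIJ, hIc, hJc] at this

/-- A code of dimension at least `k` all of whose nonzero codewords have more than
`Fintype.card ι - k` nonzero coordinates interpolates on every set of at most `k` coordinates. -/
lemma interpolates_of_card_lt_wt_add [Fintype ι] (B : Submodule F (ι → F)) (k : ℕ)
    (hk : k ≤ Module.finrank F B) (hkι : k ≤ Fintype.card ι)
    (hd : ∀ b ∈ B, b ≠ 0 → Fintype.card ι < wt b + k) (T : Finset ι) (hT : T.card ≤ k) :
    Interpolates B T := by
  classical
  obtain ⟨S, hTS, -, hSc⟩ :=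
    Finset.exists_subsuperset_card_eq (Finset.subset_univ T) hT (by simpa using hkι)
  apply Interpolates.of_ne_zero
  intro i hi
  have hiS := hTS hi
  obtain ⟨b, hb, hb0, hbz⟩ := exists_ne_zero_forall_eq_zero B (S.erase i) (by
    have := Finset.card_erase_lt_of_mem hiS
    omega)
  refine ⟨b, hb, fun hbi => ?_, fun j hj hji => hbz j (Finset.mem_erase.mpr ⟨hji, hTS hj⟩)⟩
  have hw : wt b ≤ Sᶜ.card := wt_le_card b _ fun j hj => by
    rw [Finset.mem_compl]
    intro hjS
    by_cases hji : j = i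
    · exact hj (hji ▸ hbi)
    · exact hj (hbz j (Finset.mem_erase.mpr ⟨hji, hjS⟩))
  rw [Finset.card_compl] at hw
  have := hd b hb hb0
  omega

/-- If `A` is a full-support code of dimension at least `ℓ + 2` and distance at least `n - ℓ - 2`,
and all nonzero codewords of `A * B` have weight at least `n - 2ℓ - 1`, then nonzero codewords of
`B` have weight at least `n - ℓ`. -/
lemma card_le_wt_add_of_schurProd [Fintype ι] {ℓ : ℕ} (hn : 2 * ℓ + 4 ≤ Fintype.card ι)
    {A B : Submodule F (ι → F)} (hAk : ℓ + 2 ≤ Module.finrank F A) (hAfull : fullSupport A)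
    (hAd : ∀ a ∈ A, a ≠ 0 → Fintype.card ι ≤ wt a + ℓ + 2)
    (hABd : ∀ x ∈ schurProd A B, x ≠ 0 → Fintype.card ι ≤ wt x + 2 * ℓ + 1)
    (b : ι → F) (hb : b ∈ B) (hb0 : b ≠ 0) : Fintype.card ι ≤ wt b + ℓ := by
  classical
  by_contra! hlt
  rw [wt_eq_card_filter] at hlt
  set S := univ.filter fun i => b i ≠ 0
  have hmemS : ∀ i, i ∈ S ↔ b i ≠ 0 := fun i => by simp [S]
  obtain ⟨I, hIS, hI, hIz⟩ := exists_interpolates_subset A S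
  obtain ⟨s, hs⟩ := Function.ne_iff.mp hb0
  obtain ⟨i, hi⟩ : I.Nonempty := by
    rw [Finset.nonempty_iff_ne_empty]
    rintro rfl
    obtain ⟨a, ha, has⟩ := hAfull s
    exact has (hIz a ha (by simp) s ((hmemS s).mpr hs))
  have hpos : 0 < I.card := Finset.card_pos.mpr ⟨i, hi⟩
  obtain ⟨u, hu, hu1, hu0⟩ := hI i hi
  have hx0 : u * b ≠ 0 := fun h => (hmemS i).mp (hIS hi) (by simpa [hu1] using congrFun h i)
  have hxw := hABd _ (mul_mem_schurProd hu hb) hx0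
  have hxle : wt (u * b) ≤ (S \ I.erase i).card := wt_le_card _ _ fun j hj => by
    simp only [Pi.mul_apply, ne_eq, mul_eq_zero, not_or] at hj
    refine Finset.mem_sdiff.mpr ⟨(hmemS j).mpr hj.2, fun hjI => hj.1 ?_⟩
    exact hu0 j (Finset.mem_of_mem_erase hjI) (Finset.ne_of_mem_erase hjI)
  rw [Finset.card_sdiff_of_subset ((Finset.erase_subset _ _).trans hIS),
    Finset.card_erase_of_mem hi] at hxle
  have hSc : Sᶜ.card = Fintype.card ι - S.card := Finset.card_compl S
  have hISc : I.card ≤ S.card := Finset.card_le_card hIS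
  obtain ⟨J, hJ, hJc⟩ := Finset.exists_subset_card_eq (s := Sᶜ) (n := ℓ + 1 - I.card) (by omega)
  obtain ⟨a, ha, ha0, haz⟩ := exists_ne_zero_forall_eq_zero A (I ∪ J) (by
    have := Finset.card_union_le I J
    omega)
  have haS := hIz a ha fun j hj => haz j (Finset.mem_union_left _ hj)
  have haw : wt a ≤ (Sᶜ \ J).card := wt_le_card _ _ fun j hj =>
    Finset.mem_sdiff.mpr ⟨Finset.mem_compl.mpr fun h => hj (haS j h),
      fun h => hj (haz j (Finset.mem_union_right _ h))⟩
  rw [Finset.card_sdiff_of_subset hJ] at haw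
  have := hAd a ha ha0
  omega

end Codes

/-- for an NMDS code `[n, n-2ℓ-1, 2ℓ+1]` with an `ℓ`-error-correcting pair
`(A, B)` where `A = [n, ℓ+2, n-ℓ-2]` is a full-support code, necessarily
`B^⊥ = [n, n-ℓ, ℓ+1]`, and `A*B = C^⊥` or `A*B = [n, 2ℓ+1, n-2ℓ-1]`. -/
theorem nmds_odd_ecp_case_A5 {Fq K : Type*} [Field Fq] [Fintype Fq] [Field K] [Algebra Fq K]
    {n ℓ : ℕ} (hl : 2 ≤ ℓ) (hn : 2 * ℓ < n - 3)
    (C : Submodule Fq (Fin n → Fq))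
    (hCk : Module.finrank Fq C = n - 2 * ℓ - 1)
    (hCd : hasMinDist C (2 * ℓ + 1))
    (hCdual : hasMinDist (dualCode C) (n - 2 * ℓ - 1))
    (A B : Submodule K (Fin n → K))
    (hAB : schurProd A B ≤ dualCode (extendCode Fq K C))
    (hBperp : ∃ dB, hasMinDist (dualCode B) dB ∧ ℓ < dB)
    (hAk : Module.finrank K A = ℓ + 2)
    (hAd : hasMinDist A (n - ℓ - 2))
    (hAfull : fullSupport A)
    (hEd : n < (n - ℓ - 2) + (2 * ℓ + 1)) :
    Module.finrank K (dualCode B) = n - ℓ ∧ hasMinDist (dualCode B) (ℓ + 1) ∧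
      (schurProd A B = dualCode (extendCode Fq K C) ∨
        (Module.finrank K (schurProd A B) = 2 * ℓ + 1 ∧
          hasMinDist (schurProd A B) (n - 2 * ℓ - 1))) := by
  obtain ⟨dB, hdB, hℓdB⟩ := hBperp
  have hι : Fintype.card (Fin n) = n := Fintype.card_fin n
  have hDk : Module.finrank K (dualCode (extendCode Fq K C)) ≤ 2 * ℓ + 1 := by
    obtain ⟨I, hI, hIc⟩ := exists_interpolates_card_eq_finrank C
    have h₁ := (hI.extendCode (K := K)).card_le_finrank
    have h₂ := finrank_dualCode (extendCode Fq K C)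
    omega
  have hDd : ∀ x ∈ dualCode (extendCode Fq K C), x ≠ 0 → n - 2 * ℓ - 2 < wt x := by
    refine lt_wt_of_interpolates _ _ fun T hT => Interpolates.extendCode ?_
    refine interpolates_of_lt_dual_wt C T fun c hc hc0 => ?_
    have := hCdual.2 c hc hc0
    omega
  have hABk := Submodule.finrank_mono hAB
  have hBℓ : ∀ T : Finset (Fin n), T.card ≤ ℓ → Interpolates B T := fun T hT =>
    interpolates_of_lt_dual_wt B T fun c hc hc0 => by
      have := hdB.2 c hc hc0
      omega
  have hBge : ℓ ≤ Module.finrank K B := by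
    obtain ⟨T, -, hTc⟩ := Finset.exists_subset_card_eq (s := (univ : Finset (Fin n))) (n := ℓ)
      (by rw [Finset.card_fin]; omega)
    exact hTc ▸ (hBℓ T hTc.le).card_le_finrank
  have hBd := card_le_wt_add_of_schurProd (ℓ := ℓ) (A := A) (B := B) (by omega) hAk.ge hAfull
    (fun a ha ha0 => by have := hAd.2 a ha ha0; omega)
    (fun x hx hx0 => by have := hDd x (hAB hx) hx0; omega)
  have hBle : Module.finrank K B ≤ ℓ := by
    by_contra! hlt
    have := finrank_add_le_finrank_schurProd A B ℓ hAfull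
      (interpolates_of_card_lt_wt_add B (ℓ + 1) hlt (by omega) fun b hb hb0 => by
        have := hBd b hb hb0
        omega) (by omega)
    omega
  have hBdual : Module.finrank K (dualCode B) = n - ℓ := by
    have := finrank_dualCode B
    omega
  refine ⟨hBdual, ⟨?_, fun c hc hc0 => hℓdB.trans_le (hdB.2 c hc hc0)⟩, Or.inl ?_⟩
  · obtain ⟨T, -, hTc⟩ := Finset.exists_subset_card_eq (s := (univ : Finset (Fin n)))
      (n := n - ℓ - 1) (by rw [Finset.card_fin]; omega)
    obtain ⟨c, hc, hc0, hcT⟩ := exists_ne_zero_forall_eq_zero (dualCode B) T (by omega)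
    refine ⟨c, hc, hc0, le_antisymm ?_ (hℓdB.trans_le (hdB.2 c hc hc0))⟩
    have := wt_le_card c Tᶜ fun i hi => Finset.mem_compl.mpr fun h => hi (hcT i h)
    rw [Finset.card_compl] at this
    omega
  · apply Submodule.eq_of_le_of_finrank_le hAB
    have := finrank_add_le_finrank_schurProd A B (ℓ - 1) hAfull
      (fun T hT => hBℓ T (by omega)) (by omega)
    omega
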